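/- Let G be the wallpaper group p4 given by the presentation ⟨S, T | S⁴ = T² = (ST)⁴ = 1⟩, with generating set S the images of S, T (Cayley graph the tiling 4.8²). Then the cumulative growth function satisfies, for all n > 0: γ(n) = (3 + 4n(n+1))/3 if n ≡ 0 (mod 3), γ(n) = (4 + 4n(n+1))/3 if n ≡ 1 (mod 3), and γ(n) = (3 + 4n(n+1))/3 if n ≡ 2 (mod 3); moreover γ(0) = 1. -/

import Mathlib

/-- Word length w.r.t. `S ∪ S⁻¹`. -/
noncomputable def wordLength {G : Type*} [Group G] (S : Set G) (g : G) : ℕ :=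
  sInf {n | ∃ w : List G, (∀ x ∈ w, x ∈ S ∪ S⁻¹) ∧ w.length = n ∧ w.prod = g}

/-- The spherical growth function `δ(n) = #{g : |g| = n}`. -/
noncomputable def sphericalGrowth {G : Type*} [Group G] (S : Set G) (n : ℕ) : ℕ :=
  Set.ncard {g : G | wordLength S g = n}

/-- The cumulative growth function `γ(n) = #{g : |g| ≤ n}`. -/
noncomputable def cumulativeGrowth {G : Type*} [Group G] (S : Set G) (n : ℕ) : ℕ :=
  Set.ncard {g : G | wordLength S g ≤ n}

/-- The relators of the wallpaper group `p4 = ⟨S,T | S⁴ = T² = (ST)⁴ = 1⟩`. -/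
def p4Rels : Set (FreeGroup (Fin 2)) :=
  {(FreeGroup.of 0) ^ 4, (FreeGroup.of 1) ^ 2, (FreeGroup.of 0 * FreeGroup.of 1) ^ 4}


namespace P4

/-- The vertices of the tiling `4.8²`: square `(x, y)`, corner `k`. -/
abbrev X := ℤ × ℤ × Fin 4

def rotF : X → X
  | (x, y, 0) => (x, y, 1)
  | (x, y, 1) => (x, y, 2)
  | (x, y, 2) => (x, y, 3)
  | (x, y, 3) => (x, y, 0)

def rotB : X → X
  | (x, y, 0) => (x, y, 3)
  | (x, y, 1) => (x, y, 0)
  | (x, y, 2) => (x, y, 1)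
  | (x, y, 3) => (x, y, 2)

def flipF : X → X
  | (x, y, 0) => (x + 1, y, 2)
  | (x, y, 1) => (x, y + 1, 3)
  | (x, y, 2) => (x - 1, y, 0)
  | (x, y, 3) => (x, y - 1, 1)

theorem rotB_rotF (p : X) : rotB (rotF p) = p := by
  obtain ⟨x, y, k⟩ := p
  fin_cases k <;> rfl

theorem rotF_rotB (p : X) : rotF (rotB p) = p := by
  obtain ⟨x, y, k⟩ := p
  fin_cases k <;> rfl

theorem flipF_flipF (p : X) : flipF (flipF p) = p := by
  obtain ⟨x, y, k⟩ := p
  fin_cases k <;> simp [flipF]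

def rot : Equiv.Perm X := ⟨rotF, rotB, rotB_rotF, rotF_rotB⟩

def flip : Equiv.Perm X := ⟨flipF, flipF, flipF_flipF, flipF_flipF⟩

abbrev P := PresentedGroup p4Rels

def s : P := PresentedGroup.of 0
def t : P := PresentedGroup.of 1

def gen : Fin 2 → Equiv.Perm X := ![rot⁻¹, flip]

theorem gen_zero : gen 0 = rot⁻¹ := rfl
theorem gen_one : gen 1 = flip := rfl
theorem rot_inv_apply (p : X) : rot⁻¹ p = rotB p := rfl
theorem flip_apply (p : X) : flip p = flipF p := rfl

theorem gen_rels : ∀ r ∈ p4Rels, FreeGroup.lift gen r = 1 := by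
  intro r hr
  simp only [p4Rels, Set.mem_insert_iff, Set.mem_singleton_iff] at hr
  rcases hr with rfl | rfl | rfl
  · rw [map_pow, FreeGroup.lift_apply_of, gen_zero]
    ext1 ⟨x, y, k⟩
    simp only [pow_succ, pow_zero, one_mul, Equiv.Perm.mul_apply, Equiv.Perm.one_apply,
      rot_inv_apply]
    fin_cases k <;> rfl
  · rw [map_pow, FreeGroup.lift_apply_of, gen_one]
    ext1 ⟨x, y, k⟩
    simp only [pow_succ, pow_zero, one_mul, Equiv.Perm.mul_apply, Equiv.Perm.one_apply,
      flip_apply, flipF_flipF]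
  · rw [map_pow, map_mul, FreeGroup.lift_apply_of, FreeGroup.lift_apply_of, gen_zero, gen_one]
    ext1 ⟨x, y, k⟩
    simp only [pow_succ, pow_zero, one_mul, Equiv.Perm.mul_apply, Equiv.Perm.one_apply,
      rot_inv_apply, flip_apply]
    fin_cases k <;> simp [rotB, flipF]

def rho : P →* Equiv.Perm X := PresentedGroup.toGroup gen_rels

def phi (g : P) : X := rho g⁻¹ (0, 0, 0)

theorem rho_s : rho s = rot⁻¹ := PresentedGroup.toGroup.of gen_rels
theorem rho_t : rho t = flip := PresentedGroup.toGroup.of gen_rels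

theorem phi_one : phi 1 = (0, 0, 0) := by simp [phi]

theorem phi_s (g : P) : phi (g * s) = rotF (phi g) := by
  simp only [phi, mul_inv_rev, map_mul, map_inv, rho_s, inv_inv]
  rfl

theorem phi_s' (g : P) : phi (g * s⁻¹) = rotB (phi g) := by
  simp only [phi, mul_inv_rev, map_mul, map_inv, rho_s, inv_inv]
  rfl

theorem phi_t (g : P) : phi (g * t) = flipF (phi g) := by
  simp only [phi, mul_inv_rev, map_mul, map_inv, rho_t]
  rfl

theorem s4 : s ^ 4 = 1 := by
  have : ((FreeGroup.of 0) ^ 4 : FreeGroup (Fin 2)) ∈ p4Rels := by simp [p4Rels]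
  exact PresentedGroup.one_of_mem this

theorem t2 : t ^ 2 = 1 := by
  have : ((FreeGroup.of 1) ^ 2 : FreeGroup (Fin 2)) ∈ p4Rels := by simp [p4Rels]
  exact PresentedGroup.one_of_mem this

theorem st4 : (s * t) ^ 4 = 1 := by
  have : ((FreeGroup.of 0 * FreeGroup.of 1) ^ 4 : FreeGroup (Fin 2)) ∈ p4Rels := by simp [p4Rels]
  exact PresentedGroup.one_of_mem this

theorem t_inv : t⁻¹ = t := by
  have := t2
  rw [pow_two] at this
  exact inv_eq_of_mul_eq_one_left this

def a : P := t * s ^ 2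
def b : P := s * t * s

theorem ab_comm : Commute a b := by
  have h4 : s * s * s * s = 1 := by simpa [pow_succ] using s4
  have h2 : t * t = 1 := by simpa [pow_succ] using t2
  have h8 : s * t * (s * t) * (s * t) * (s * t) = 1 := by simpa [pow_succ] using st4
  have e1 : s * t * s * t = t * s⁻¹ * t * s⁻¹ := by
    have h : s * t * s * t = (s * t * s * t)⁻¹ := by
      rw [eq_inv_iff_mul_eq_one]
      simpa [mul_assoc] using h8
    calc s * t * s * t = (s * t * s * t)⁻¹ := h
      _ = t * s⁻¹ * t * s⁻¹ := by simp [mul_inv_rev, t_inv, mul_assoc]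
  have e3 : s * s * s = s⁻¹ := eq_inv_of_mul_eq_one_left h4
  change t * s ^ 2 * (s * t * s) = s * t * s * (t * s ^ 2)
  calc t * s ^ 2 * (s * t * s) = t * (s * s * s) * t * s := by simp [pow_two, mul_assoc]
    _ = t * s⁻¹ * t * s⁻¹ * (s * s) := by rw [e3]; simp [mul_assoc]
    _ = s * t * s * t * (s * s) := by rw [e1]
    _ = _ := by simp [pow_two, mul_assoc]

def sigma (p : X) : P := a ^ p.1 * b ^ p.2.1 * s ^ (p.2.2 : ℕ)

theorem sigma_rot (p : X) : sigma (rotF p) = sigma p * s := by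
  obtain ⟨x, y, k⟩ := p
  have := s4
  fin_cases k
  · simp [sigma, rotF]
  · simp [sigma, rotF, mul_assoc, pow_succ]
  · simp [sigma, rotF, mul_assoc, pow_succ]
  · have : s * (s * (s * s)) = 1 := by simpa [pow_succ, mul_assoc] using s4
    simp [sigma, rotF, mul_assoc, pow_succ, this]

theorem sigma_flip (p : X) : sigma (flipF p) = sigma p * t := by
  obtain ⟨x, y, k⟩ := p
  have h4 : s * (s * (s * s)) = 1 := by simpa [pow_succ, mul_assoc] using s4
  have h4' : s⁻¹ * s⁻¹ = s * s := by
    rw [← mul_inv_rev, inv_eq_iff_mul_eq_one]; simpa [mul_assoc] using h4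
  have h4'' : s⁻¹ * (s⁻¹ * s⁻¹) = s := by
    rw [h4', inv_mul_cancel_left]
  have h2 : t * t = 1 := by simpa [pow_succ] using t2
  have hb : ∀ z : ℤ, b ^ y * a ^ z = a ^ z * b ^ y := fun z =>
    ((ab_comm.zpow_zpow z y).eq).symm
  have ha : a ^ x * a = a ^ (x + 1) := by rw [zpow_add_one]
  have ka : a * s ^ 2 = t := by simp [a, pow_two, mul_assoc, h4]
  have ka' : a⁻¹ = s ^ 2 * t := by simp [a, pow_two, t_inv, h4']
  have kb : b * s ^ 3 = s * t := by simp [b, pow_succ, mul_assoc, h4]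
  have kb' : b⁻¹ * s = s ^ 3 * t := by
    have : b⁻¹ = s⁻¹ * t * s⁻¹ := by simp [b, t_inv, mul_assoc]
    rw [this]
    have e3 : s ^ 3 = s⁻¹ := eq_inv_of_mul_eq_one_left (by simpa [pow_succ, mul_assoc] using h4)
    rw [e3]; simp
  have hb1 : b ^ y * a = a * b ^ y := by simpa using hb 1
  have hb2 : b ^ y * a⁻¹ = a⁻¹ * b ^ y := by simpa using hb (-1)
  fin_cases k
  · change a ^ (x + 1) * b ^ y * s ^ 2 = a ^ x * b ^ y * s ^ 0 * t
    rw [zpow_add_one, mul_assoc (a ^ x), ← hb1, ← ka]; simp [mul_assoc]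
  · change a ^ x * b ^ (y + 1) * s ^ 3 = a ^ x * b ^ y * s ^ 1 * t
    rw [zpow_add_one, pow_one, mul_assoc _ s t, ← kb]; simp [mul_assoc]
  · change a ^ (x - 1) * b ^ y * s ^ 0 = a ^ x * b ^ y * s ^ 2 * t
    rw [zpow_sub_one, mul_assoc (a ^ x), ← hb2, mul_assoc _ (s ^ 2) t, ← ka']; simp [mul_assoc]
  · change a ^ x * b ^ (y - 1) * s ^ 1 = a ^ x * b ^ y * s ^ 3 * t
    rw [zpow_sub_one, pow_one, mul_assoc _ (s ^ 3) t, ← kb']; simp [mul_assoc]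

theorem sigma_rotB (p : X) : sigma (rotB p) = sigma p * s⁻¹ := by
  rw [eq_mul_inv_iff_mul_eq, ← sigma_rot, rotF_rotB]

abbrev gens : Set P := Set.range (PresentedGroup.of (rels := p4Rels))

theorem gens_cases {x : P} (hx : x ∈ gens ∪ gens⁻¹) : x = s ∨ x = s⁻¹ ∨ x = t := by
  rcases hx with ⟨i, rfl⟩ | ⟨i, hi⟩
  · fin_cases i
    · exact Or.inl rfl
    · exact Or.inr (Or.inr rfl)
  · fin_cases i
    · exact Or.inr (Or.inl (by rw [← inv_inv x, ← hi]; rfl))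
    · refine Or.inr (Or.inr ?_)
      rw [← inv_inv x, ← hi]
      exact t_inv

theorem s_mem : s ∈ gens ∪ gens⁻¹ := Or.inl ⟨0, rfl⟩
theorem t_mem : t ∈ gens ∪ gens⁻¹ := Or.inl ⟨1, rfl⟩
theorem s_inv_mem : s⁻¹ ∈ gens ∪ gens⁻¹ := Or.inr ⟨0, by simp [s]⟩

/-- The explicit length function. -/
def lenZ : X → ℤ
  | (x, y, k) =>
    (if x.natAbs ≤ y.natAbs then 3 * (y.natAbs : ℤ) + x.natAbs
      else 3 * (x.natAbs : ℤ) + y.natAbs)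
    + (if k = 1 ∨ k = 2 then (if y < x then -1 else 1) else 0)
    + (if k = 3 ∨ k = 2 then (if -y < x then -1 else 1) else 0)

theorem lenZ_nonneg (p : X) : 0 ≤ lenZ p := by
  obtain ⟨x, y, k⟩ := p
  fin_cases k <;> simp [-Nat.cast_natAbs, lenZ] <;> split_ifs <;> omega

theorem lenZ_rotF (p : X) : lenZ (rotF p) ≤ lenZ p + 1 := by
  obtain ⟨x, y, k⟩ := p
  fin_cases k <;> simp [-Nat.cast_natAbs, lenZ, rotF] <;> split_ifs <;> omega

theorem lenZ_rotB (p : X) : lenZ (rotB p) ≤ lenZ p + 1 := by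
  obtain ⟨x, y, k⟩ := p
  fin_cases k <;> simp [-Nat.cast_natAbs, lenZ, rotB] <;> split_ifs <;> omega

theorem lenZ_flip (p : X) : lenZ (flipF p) ≤ lenZ p + 1 := by
  obtain ⟨x, y, k⟩ := p
  fin_cases k <;> simp only [lenZ, flipF] <;> simp [-Nat.cast_natAbs] <;> split_ifs <;> omega

theorem lenZ_descent (p : X) (hp : p ≠ (0, 0, 0)) :
    lenZ (rotF p) < lenZ p ∨ lenZ (rotB p) < lenZ p ∨ lenZ (flipF p) < lenZ p := by
  obtain ⟨x, y, k⟩ := p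
  have hk : k ≠ 0 ∨ x ≠ 0 ∨ y ≠ 0 := by
    by_contra! h
    exact hp (by rw [h.1, h.2.1, h.2.2])
  fin_cases k <;> simp [-Nat.cast_natAbs, lenZ, rotF, rotB, flipF] at hk ⊢ <;> grind

theorem exists_word (n : ℕ) : ∀ p : X, lenZ p ≤ n →
    ∃ w : List P, (∀ x ∈ w, x ∈ gens ∪ gens⁻¹) ∧ w.length ≤ n ∧ phi w.prod = p := by
  induction n with
  | zero =>
    intro p hp
    refine ⟨[], by simp, by simp, ?_⟩
    by_contra h
    have hp' : p ≠ (0, 0, 0) := fun h' => h (by rw [h', List.prod_nil, phi_one])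
    have h1 := lenZ_nonneg (rotF p)
    have h2 := lenZ_nonneg (rotB p)
    have h3 := lenZ_nonneg (flipF p)
    have := lenZ_descent p hp'
    push_cast at hp
    omega
  | succ n ih =>
    intro p hp
    push_cast at hp
    have step : ∀ (q : X) (g : P), g ∈ gens ∪ gens⁻¹ → lenZ q ≤ n →
        (∀ h, phi h = q → phi (h * g) = p) →
        ∃ w : List P, (∀ x ∈ w, x ∈ gens ∪ gens⁻¹) ∧ w.length ≤ n + 1 ∧ phi w.prod = p := by
      intro q g hg hq hqp
      obtain ⟨w, h1, h2, h3⟩ := ih q hq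
      refine ⟨w ++ [g], ?_, by simpa using h2, ?_⟩
      · intro x hx
        rcases List.mem_append.1 hx with hx | hx
        · exact h1 x hx
        · rw [List.mem_singleton.1 hx]; exact hg
      · rw [List.prod_append, List.prod_singleton]
        exact hqp _ h3
    by_cases hp0 : p = (0, 0, 0)
    · exact ⟨[], by simp, by simp, by rw [hp0, List.prod_nil, phi_one]⟩
    rcases lenZ_descent p hp0 with h | h | h
    · exact step (rotF p) s⁻¹ s_inv_mem (by omega)
        (fun h hh => by rw [phi_s', hh, rotB_rotF])
    · exact step (rotB p) s s_mem (by omega)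
        (fun h hh => by rw [phi_s, hh, rotF_rotB])
    · exact step (flipF p) t t_mem (by omega)
        (fun h hh => by rw [phi_t, hh, flipF_flipF])

theorem word_bound (w : List P) : (∀ x ∈ w, x ∈ gens ∪ gens⁻¹) →
    lenZ (phi w.prod) ≤ w.length ∧ sigma (phi w.prod) = w.prod := by
  induction w using List.reverseRecOn with
  | nil =>
    intro _
    rw [List.prod_nil, phi_one]
    simp [-Nat.cast_natAbs, lenZ, sigma]
  | append_singleton w g ih =>
    intro h
    obtain ⟨h1, h2⟩ := ih (fun x hx => h x (by simp [hx]))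
    have hl : ((w ++ [g]).length : ℤ) = w.length + 1 := by simp
    rw [List.prod_append, List.prod_singleton, hl]
    have r1 := lenZ_rotF (phi w.prod)
    have r2 := lenZ_rotB (phi w.prod)
    have r3 := lenZ_flip (phi w.prod)
    rcases gens_cases (h g (by simp)) with rfl | rfl | rfl
    · rw [phi_s, sigma_rot, h2]; exact ⟨by omega, rfl⟩
    · rw [phi_s', sigma_rotB, h2]; exact ⟨by omega, rfl⟩
    · rw [phi_t, sigma_flip, h2]; exact ⟨by omega, rfl⟩

theorem sigma_phi (g : P) : sigma (phi g) = g := by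
  have hg : g ∈ Subgroup.closure gens := by
    rw [PresentedGroup.closure_range_of]; trivial
  induction hg using Subgroup.closure_induction_right with
  | one => rw [phi_one]; simp [sigma]
  | mul_right x hx y hy ih =>
    rcases gens_cases (Or.inl hy) with rfl | rfl | rfl
    · rw [phi_s, sigma_rot, ih]
    · rw [phi_s', sigma_rotB, ih]
    · rw [phi_t, sigma_flip, ih]
  | mul_inv_cancel x hx y hy ih =>
    rcases gens_cases (x := y⁻¹) (Or.inr (by simpa using hy)) with h | h | h
    · rw [h, phi_s, sigma_rot, ih]
    · rw [h, phi_s', sigma_rotB, ih]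
    · rw [h, phi_t, sigma_flip, ih]

theorem phi_injective : Function.Injective phi := fun g h e => by
  rw [← sigma_phi g, e, sigma_phi]

theorem wordLength_le_iff (g : P) (n : ℕ) : wordLength gens g ≤ n ↔ lenZ (phi g) ≤ n := by
  constructor
  · intro h
    have hne : {n | ∃ w : List P, (∀ x ∈ w, x ∈ gens ∪ gens⁻¹) ∧ w.length = n ∧
        w.prod = g}.Nonempty := by
      obtain ⟨w, h1, h2, h3⟩ := exists_word (lenZ (phi g)).toNat (phi g) (Int.self_le_toNat _)
      exact ⟨w.length, w, h1, rfl, phi_injective h3⟩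
    obtain ⟨w, h1, h2, h3⟩ := Nat.sInf_mem hne
    have := (word_bound w h1).1
    rw [h3, h2] at this
    exact this.trans (by exact_mod_cast h)
  · intro h
    obtain ⟨w, h1, h2, h3⟩ := exists_word n (phi g) h
    exact le_trans (Nat.sInf_le (show w.length ∈ {n | ∃ w : List P, (∀ x ∈ w, x ∈ gens ∪ gens⁻¹) ∧
      w.length = n ∧ w.prod = g} from ⟨w, h1, rfl, phi_injective h3⟩)) h2

def B (n : ℕ) : Set X := {p | lenZ p ≤ n}

theorem growth_eq (n : ℕ) : cumulativeGrowth gens n = (B n).ncard := by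
  unfold cumulativeGrowth
  rw [← Set.ncard_image_of_injective _ phi_injective]
  congr 1
  ext p
  constructor
  · rintro ⟨g, hg, rfl⟩
    exact (wordLength_le_iff g n).1 hg
  · intro hp
    obtain ⟨w, h1, h2, h3⟩ := exists_word n p hp
    refine ⟨w.prod, ?_, h3⟩
    exact (wordLength_le_iff _ n).2 (by rw [h3]; exact hp)

noncomputable def box (n : ℕ) : Finset X :=
  Finset.Icc (-(n : ℤ)) n ×ˢ Finset.Icc (-(n : ℤ)) n ×ˢ Finset.univ

theorem lenZ_box (p : X) (n : ℕ) (h : lenZ p ≤ n) : p ∈ box n := by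
  obtain ⟨x, y, k⟩ := p
  simp only [box, Finset.mem_product, Finset.mem_Icc, Finset.mem_univ, and_true]
  fin_cases k <;> simp [-Nat.cast_natAbs, lenZ] at h <;> split_ifs at h <;> omega

theorem B_eq (n : ℕ) : B n = ((box n).filter (fun p => lenZ p ≤ n) : Finset X) := by
  ext p
  simp only [B, Set.mem_setOf_eq, Finset.coe_filter]
  exact ⟨fun h => ⟨lenZ_box p n h, h⟩, fun h => h.2⟩

theorem B_finite (n : ℕ) : (B n).Finite := by
  rw [B_eq]; exact Finset.finite_toSet _

theorem B_zero : (B 0).ncard = 1 := by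
  rw [B_eq, Set.ncard_coe_finset]; decide +kernel

theorem B_one : (B 1).ncard = 4 := by
  rw [B_eq, Set.ncard_coe_finset]; decide +kernel

theorem B_two : (B 2).ncard = 9 := by
  rw [B_eq, Set.ncard_coe_finset]; decide +kernel

/-- Push every vertex outward by one in its quadrant. -/
def push : X → X
  | (x, y, k) =>
    if y < x then (if -y < x then (x + 1, y, k) else (x, y - 1, k))
    else (if -y < x then (x, y + 1, k) else (x - 1, y, k))

theorem push_len (p : X) : lenZ (push p) = lenZ p + 3 := by
  obtain ⟨x, y, k⟩ := p
  unfold push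
  fin_cases k <;> simp <;> split_ifs <;> simp [-Nat.cast_natAbs, lenZ] <;> split_ifs <;> omega

theorem push_injective : Function.Injective push := by
  rintro ⟨x, y, k⟩ ⟨x', y', k'⟩ h
  unfold push at h
  simp only at h
  split_ifs at h <;> simp only [Prod.mk.injEq] at h ⊢ <;> refine ⟨?_, ?_, h.2.2⟩ <;> omega

def ray : Fin 8 → ℕ → ℤ × ℤ
  | 0, j => (j + 1, j)
  | 1, j => (j + 2, -j - 1)
  | 2, j => (j + 1, j + 1)
  | 3, j => (-j, j + 1)
  | 4, j => (-j, -j)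
  | 5, j => (-j - 1, j + 1)
  | 6, j => (-j, -j - 1)
  | 7, j => (j + 1, -j - 1)

def rayX (q : (Fin 4 × Fin 8) × ℕ) : X := ((ray q.1.2 q.2).1, (ray q.1.2 q.2).2, q.1.1)

def ray0 (q : Fin 4 × Fin 8) : ℕ := (lenZ (rayX (q, 0))).toNat

theorem ray_len (q : Fin 4 × Fin 8) (j : ℕ) : lenZ (rayX (q, j)) = ray0 q + 4 * j := by
  obtain ⟨k, r⟩ := q
  have e : (ray0 (k, r) : ℤ) = lenZ (rayX ((k, r), 0)) := Int.toNat_of_nonneg (lenZ_nonneg _)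
  rw [e]
  fin_cases k <;> fin_cases r <;> simp [-Nat.cast_natAbs, lenZ, rayX, ray] <;> grind

theorem ray_injective : Function.Injective rayX := by
  rintro ⟨⟨k, r⟩, j⟩ ⟨⟨k', r'⟩, j'⟩ h
  simp only [rayX, Prod.mk.injEq] at h ⊢
  obtain ⟨h1, h2, h3⟩ := h
  have : r = r' ∧ j = j' := by
    clear h3
    fin_cases r <;> fin_cases r' <;> simp [ray] at h1 h2 ⊢ <;> omega
  exact ⟨⟨h3, this.1⟩, this.2⟩

theorem ray_not_push (q : (Fin 4 × Fin 8) × ℕ) (p : X) : push p ≠ rayX q := by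
  obtain ⟨⟨k, r⟩, j⟩ := q
  obtain ⟨x, y, k'⟩ := p
  intro h
  unfold push rayX at h
  simp only at h
  fin_cases r <;> simp only [ray] at h <;> split_ifs at h <;>
    simp only [Prod.mk.injEq] at h <;> omega

theorem push_or_ray (p : X) : (∃ q, push q = p) ∨ ∃ q, rayX q = p := by
  obtain ⟨x, y, k⟩ := p
  by_cases h1 : y < x ∧ -y < x
  · by_cases h : y < x - 1 ∧ -y < x - 1
    · left; refine ⟨(x - 1, y, k), ?_⟩; simp [push, h]
    · right
      by_cases h0 : 0 ≤ y
      · refine ⟨((k, 0), y.toNat), ?_⟩; simp [rayX, ray]; omega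
      · refine ⟨((k, 1), (-y - 1).toNat), ?_⟩; simp [rayX, ray]; omega
  by_cases h2 : ¬ y < x ∧ -y < x
  · by_cases h : ¬ y - 1 < x ∧ -(y - 1) < x
    · left; refine ⟨(x, y - 1, k), ?_⟩; simp only [push, if_neg h.1, if_pos h.2]; simp
    · right
      by_cases h0 : x = y
      · refine ⟨((k, 2), (y - 1).toNat), ?_⟩; simp [rayX, ray]; omega
      · refine ⟨((k, 3), (y - 1).toNat), ?_⟩; simp [rayX, ray]; omega
  by_cases h3 : ¬ y < x ∧ ¬ -y < x
  · by_cases h : ¬ y < x + 1 ∧ ¬ -y < x + 1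
    · left; refine ⟨(x + 1, y, k), ?_⟩; simp only [push, if_neg h.1, if_neg h.2]; simp
    · right
      by_cases h0 : x = y
      · refine ⟨((k, 4), (-y).toNat), ?_⟩; simp [rayX, ray]; omega
      · refine ⟨((k, 5), (y - 1).toNat), ?_⟩; simp [rayX, ray]; omega
  · by_cases h : y + 1 < x ∧ ¬ -(y + 1) < x
    · left; refine ⟨(x, y + 1, k), ?_⟩; simp only [push, if_pos h.1, if_neg h.2]; simp
    · right
      by_cases h0 : x = y + 1
      · refine ⟨((k, 6), (-y - 1).toNat), ?_⟩; simp [rayX, ray]; omega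
      · refine ⟨((k, 7), (-y - 1).toNat), ?_⟩; simp [rayX, ray]; omega

def rays (n : ℕ) : Finset ((Fin 4 × Fin 8) × ℕ) :=
  (Finset.univ.sigma fun q => Finset.range ((n + 7 - ray0 q) / 4)).map
    (Equiv.sigmaEquivProd (Fin 4 × Fin 8) ℕ).toEmbedding

theorem ray0_le : ∀ q, ray0 q ≤ 7 := by decide +kernel

theorem mem_rays (n : ℕ) (q : (Fin 4 × Fin 8) × ℕ) :
    q ∈ rays n ↔ lenZ (rayX q) ≤ (n + 3 : ℕ) := by
  obtain ⟨q, j⟩ := q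
  have := ray0_le q
  rw [ray_len]
  simp only [rays, Finset.mem_map_equiv]
  simp [Equiv.sigmaEquivProd]
  omega

def ray0Tab : Fin 4 → Fin 8 → ℕ :=
  ![![3, 7, 4, 3, 0, 4, 3, 4],
    ![2, 6, 5, 4, 1, 5, 2, 3],
    ![1, 5, 4, 3, 2, 6, 3, 4],
    ![2, 6, 3, 2, 1, 5, 4, 5]]

theorem card_rays (n : ℕ) : (rays n).card = 8 * n + 16 := by
  simp only [rays, Finset.card_map, Finset.card_sigma, Finset.card_range]
  have key : ∀ q : Fin 4 × Fin 8, ray0 q = ray0Tab q.1 q.2 := by decide +kernel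
  simp only [key, Fintype.sum_prod_type, Fin.sum_univ_succ, Fin.sum_univ_zero]
  simp [ray0Tab]
  omega

theorem B_succ (n : ℕ) : (B (n + 3)).ncard = (B n).ncard + (8 * n + 16) := by
  have e : B (n + 3) = push '' B n ∪ rayX '' (rays n : Set ((Fin 4 × Fin 8) × ℕ)) := by
    ext p
    constructor
    · intro hp
      rcases push_or_ray p with ⟨q, rfl⟩ | ⟨q, rfl⟩
      · left
        refine ⟨q, ?_, rfl⟩
        have := push_len q
        simp only [B, Set.mem_setOf_eq] at hp ⊢
        push_cast at hp
        omega
      · right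
        exact ⟨q, (mem_rays n q).2 hp, rfl⟩
    · rintro (⟨q, hq, rfl⟩ | ⟨q, hq, rfl⟩)
      · have := push_len q
        simp only [B, Set.mem_setOf_eq] at hq ⊢
        push_cast
        omega
      · exact (mem_rays n q).1 hq
  rw [e, Set.ncard_union_eq ?_ ((B_finite n).image _) ((Finset.finite_toSet _).image _),
    Set.ncard_image_of_injective _ push_injective, Set.ncard_image_of_injective _ ray_injective,
    Set.ncard_coe_finset, card_rays]
  rw [Set.disjoint_left]
  rintro _ ⟨p, _, rfl⟩ ⟨q, _, h⟩
  exact ray_not_push q p h.symm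

theorem B_card (m : ℕ) : (B (3 * m)).ncard = 1 + 4 * m * (3 * m + 1) ∧
    (B (3 * m + 1)).ncard = 4 + 4 * m * (3 * m + 3) ∧
    (B (3 * m + 2)).ncard = 9 + 4 * m * (3 * m + 5) := by
  induction m with
  | zero => exact ⟨B_zero, B_one, B_two⟩
  | succ m ih =>
    obtain ⟨h1, h2, h3⟩ := ih
    refine ⟨?_, ?_, ?_⟩
    · rw [show 3 * (m + 1) = 3 * m + 3 by ring, B_succ, h1]; ring
    · rw [show 3 * (m + 1) + 1 = 3 * m + 1 + 3 by ring, B_succ, h2]; ring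
    · rw [show 3 * (m + 1) + 2 = 3 * m + 2 + 3 by ring, B_succ, h3]; ring

end P4

/-- Cumulative growth of `p4` with generators `S,T` (Cayley graph: the tiling `4.8²`):
`γ(0) = 1` and for `n > 0`: `γ(n) = (3 + 4n(n+1))/3` if `n ≡ 0 or 2 (mod 3)` and
`γ(n) = (4 + 4n(n+1))/3` if `n ≡ 1 (mod 3)` (stated multiplied by 3 to avoid division). -/
theorem cumulativeGrowth_p4 :
    cumulativeGrowth (Set.range (PresentedGroup.of (rels := p4Rels))) 0 = 1 ∧
    ∀ n : ℕ, 0 < n →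
      (n % 3 = 0 →
        3 * cumulativeGrowth (Set.range (PresentedGroup.of (rels := p4Rels))) n =
          3 + 4 * n * (n + 1)) ∧
      (n % 3 = 1 →
        3 * cumulativeGrowth (Set.range (PresentedGroup.of (rels := p4Rels))) n =
          4 + 4 * n * (n + 1)) ∧
      (n % 3 = 2 →
        3 * cumulativeGrowth (Set.range (PresentedGroup.of (rels := p4Rels))) n =
          3 + 4 * n * (n + 1)) := by
  refine ⟨by rw [P4.growth_eq, P4.B_zero], ?_⟩
  intro n _
  rw [P4.growth_eq]
  refine ⟨fun h => ?_, fun h => ?_, fun h => ?_⟩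
  · obtain ⟨m, rfl⟩ : ∃ m, n = 3 * m := ⟨n / 3, by omega⟩
    rw [(P4.B_card m).1]; ring
  · obtain ⟨m, rfl⟩ : ∃ m, n = 3 * m + 1 := ⟨n / 3, by omega⟩
    rw [(P4.B_card m).2.1]; ring
  · obtain ⟨m, rfl⟩ : ∃ m, n = 3 * m + 2 := ⟨n / 3, by omega⟩
    rw [(P4.B_card m).2.2]; ring
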